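/- Let Ω ⊆ ℝ^{n+1} be a nonempty proper open convex cone and let F be a canonical potential of Ω. If G : Ω → ℝ is a C² convex function satisfying det D²G(x) ≥ e^{2G(x)} for every x ∈ Ω, then G(x) ≤ F(x) for every x ∈ Ω. -/

import Mathlib

open scoped RealInnerProductSpace

noncomputable section

abbrev Euc (m : ℕ) : Type := EuclideanSpace ℝ (Fin m)

/-- The Hessian matrix of `F` at `x` in the standard coordinates. -/
def hessMatrix {m : ℕ} (F : Euc m → ℝ) (x : Euc m) : Matrix (Fin m) (Fin m) ℝ :=
  fun i j => iteratedFDeriv ℝ 2 F x ![EuclideanSpace.single i 1, EuclideanSpace.single j 1]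

/-- A nonempty proper open convex cone in `ℝ^m`. -/
def IsOpenProperConvexCone {m : ℕ} (Ω : Set (Euc m)) : Prop :=
  Ω.Nonempty ∧ IsOpen Ω ∧ Convex ℝ Ω ∧
    (∀ x ∈ Ω, ∀ t : ℝ, Real.exp t • x ∈ Ω) ∧
    ¬ ∃ p v : Euc m, v ≠ 0 ∧ ∀ t : ℝ, p + t • v ∈ closure Ω

/-- `F` tends to `+∞` along every sequence in `Ω` converging to a boundary point of `Ω`. -/
def BlowsUpOnBoundary {m : ℕ} (Ω : Set (Euc m)) (F : Euc m → ℝ) : Prop :=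
  ∀ z ∈ frontier Ω, ∀ x : ℕ → Euc m, (∀ k, x k ∈ Ω) →
    Filter.Tendsto x Filter.atTop (nhds z) →
    Filter.Tendsto (fun k => F (x k)) Filter.atTop Filter.atTop

/-- The canonical potential of a proper open convex cone `Ω ⊆ ℝ^{n+1}`. -/
def IsCanonicalPotential (n : ℕ) (Ω : Set (Euc (n+1))) (F : Euc (n+1) → ℝ) : Prop :=
  ContDiffOn ℝ (⊤ : ℕ∞) F Ω ∧
  (∀ x ∈ Ω, (hessMatrix F x).PosDef) ∧
  (∀ x ∈ Ω, (hessMatrix F x).det = Real.exp (2 * F x)) ∧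
  (∀ x ∈ Ω, ∀ t : ℝ, F (Real.exp t • x) = F x - (n + 1) * t) ∧
  BlowsUpOnBoundary Ω F

/-- The open dual cone of `Ω`. -/
def openDualCone {m : ℕ} (Ω : Set (Euc m)) : Set (Euc m) :=
  {y | ∀ x ∈ closure Ω, x ≠ 0 → 0 < ⟪x, y⟫}


lemma det_one_add_ge {m : ℕ} (Q : Matrix (Fin m) (Fin m) ℝ) (hQ : Q.PosSemidef) :
    1 ≤ (1 + Q).det := by
  have h1 : (1 + Q).IsHermitian := Matrix.isHermitian_one.add hQ.1
  rw [h1.det_eq_prod_eigenvalues]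
  have key : ∀ i, 1 ≤ h1.eigenvalues i := by
    intro i
    have h2 := h1.mulVec_eigenvectorBasis i
    set v : Fin m → ℝ := ⇑(h1.eigenvectorBasis i) with hv
    have h3 := hQ.dotProduct_mulVec_nonneg v
    have h4 : v ⬝ᵥ v = 1 := by
      have := h1.eigenvectorBasis.orthonormal.1 i
      have h5 : ⟪h1.eigenvectorBasis i, h1.eigenvectorBasis i⟫ = 1 := by
        rw [real_inner_self_eq_norm_sq, this]; norm_num
      rw [EuclideanSpace.inner_eq_star_dotProduct] at h5
      simpa using h5
    rw [Matrix.add_mulVec, Matrix.one_mulVec] at h2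
    have h6 := congrArg (fun w => v ⬝ᵥ w) h2
    simp only [dotProduct_add, dotProduct_smul, h4, smul_eq_mul, mul_one] at h6
    simp only [star_trivial] at h3
    linarith
  simp only [RCLike.ofReal_real_eq_id, id]
  calc (1:ℝ) = ∏ _i : Fin m, (1:ℝ) := by simp
    _ ≤ _ := Finset.prod_le_prod (fun _ _ => zero_le_one) (fun i _ => key i)

lemma det_mono {m : ℕ} (A B : Matrix (Fin m) (Fin m) ℝ) (hA : A.PosSemidef)
    (hBA : (B - A).PosSemidef) : A.det ≤ B.det := by
  have hB : B.PosSemidef := by simpa using hA.add hBA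
  rcases eq_or_ne A.det 0 with h0 | h0
  · rw [h0]; exact hB.det_nonneg
  obtain ⟨C, rfl⟩ : ∃ C : Matrix (Fin m) (Fin m) ℝ, A = C.conjTranspose * C := by
    open scoped MatrixOrder Matrix.Norms.L2Operator in
    exact CStarAlgebra.nonneg_iff_eq_star_mul_self.mp hA.nonneg
  have hC : IsUnit C.det := by
    rw [Matrix.det_mul] at h0
    exact isUnit_iff_ne_zero.2 (right_ne_zero_of_mul h0)
  have hCC : C * C⁻¹ = 1 := Matrix.mul_nonsing_inv C hC
  have hCC' : C⁻¹ * C = 1 := Matrix.nonsing_inv_mul C hC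
  have h1 := det_one_add_ge _ (hBA.conjTranspose_mul_mul_same C⁻¹)
  have hD : C.conjTranspose * (C⁻¹).conjTranspose = 1 := by
    rw [← Matrix.conjTranspose_mul, hCC', Matrix.conjTranspose_one]
  have e : B = C.conjTranspose * (1 + (C⁻¹).conjTranspose * (B - C.conjTranspose * C) * C⁻¹) * C := by
    rw [mul_add, add_mul, mul_one]
    have : C.conjTranspose * ((C⁻¹).conjTranspose * (B - C.conjTranspose * C) * C⁻¹) * C
      = (C.conjTranspose * (C⁻¹).conjTranspose) * (B - C.conjTranspose * C) * (C⁻¹ * C) := by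
      simp only [mul_assoc]
    rw [this, hD, hCC']; simp
  have h2 : 0 ≤ (C.conjTranspose * C).det := hA.det_nonneg
  rw [Matrix.det_mul] at h2
  calc (C.conjTranspose * C).det = C.conjTranspose.det * C.det := Matrix.det_mul _ _
    _ ≤ C.conjTranspose.det * C.det * (1 + (C⁻¹).conjTranspose * (B - C.conjTranspose * C) * C⁻¹).det :=
        le_mul_of_one_le_right h2 h1
    _ = B.det := by
        conv_rhs => rw [e]
        rw [Matrix.det_mul, Matrix.det_mul]; ring

lemma second_deriv_nonneg_of_localMin (g : ℝ → ℝ) (hg : ContinuousAt g 0)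
    (hmin : IsLocalMin g 0) : 0 ≤ deriv (deriv g) 0 := by
  by_contra h
  push Not at h
  have hd : deriv g 0 = 0 := hmin.deriv_eq_zero
  have hmax := isLocalMax_of_deriv_deriv_neg h hd hg
  have hc : g =ᶠ[nhds 0] fun _ => g 0 := by
    filter_upwards [hmin, hmax] with t h1 h2
    exact le_antisymm h2 h1
  have := hc.deriv.deriv_eq
  simp at this
  linarith

lemma snd_fderiv_nonneg_of_localMin {m : ℕ} (f : Euc m → ℝ) (x v : Euc m)
    (hf : ContDiffAt ℝ 2 f x) (hmin : IsLocalMin f x) :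
    0 ≤ fderiv ℝ (fderiv ℝ f) x v v := by
  have hline : ∀ t : ℝ, HasDerivAt (fun t : ℝ => x + t • v) v t := by
    intro t
    simpa using ((hasDerivAt_id t).smul_const v).const_add x
  have hcont : Filter.Tendsto (fun t : ℝ => x + t • v) (nhds 0) (nhds x) := by
    have := (hline 0).continuousAt.tendsto
    simpa using this
  have h1 : ∀ᶠ y in nhds x, DifferentiableAt ℝ f y := by
    filter_upwards [hf.eventually (by simp)] with y hy
    exact hy.differentiableAt (by simp)
  have h2 : DifferentiableAt ℝ (fderiv ℝ f) x :=
    (hf.fderiv_right (m := 1) (by norm_num)).differentiableAt (by simp)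
  have h3 : deriv (fun t : ℝ => f (x + t • v)) =ᶠ[nhds 0] fun t => fderiv ℝ f (x + t • v) v := by
    filter_upwards [hcont.eventually h1] with t ht
    exact (ht.hasFDerivAt.comp_hasDerivAt t (hline t)).deriv
  have h4 : deriv (deriv (fun t : ℝ => f (x + t • v))) 0 = fderiv ℝ (fderiv ℝ f) x v v := by
    rw [h3.deriv_eq]
    have h5 : HasFDerivAt (fderiv ℝ f) (fderiv ℝ (fderiv ℝ f) x) (x + (0:ℝ) • v) := by
      simpa using h2.hasFDerivAt
    have h6 := h5.comp_hasDerivAt 0 (hline 0)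
    have h7 := h6.clm_apply (hasDerivAt_const (0:ℝ) v)
    simpa using h7.deriv
  rw [← h4]
  apply second_deriv_nonneg_of_localMin
  · have : ContinuousAt f (x + (0:ℝ) • v) := by simpa using hf.continuousAt
    exact ContinuousAt.comp (f := fun t : ℝ => x + t • v) this (hline 0).continuousAt
  · have := hcont.eventually hmin
    simpa [IsLocalMin, IsMinFilter] using this

lemma hessMatrix_apply {m : ℕ} (f : Euc m → ℝ) (x : Euc m) (i j : Fin m) :
    hessMatrix f x i j = fderiv ℝ (fderiv ℝ f) x (EuclideanSpace.single i 1)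
      (EuclideanSpace.single j 1) := by
  simp [hessMatrix, iteratedFDeriv_two_apply]

lemma hess_quad {m : ℕ} (f : Euc m → ℝ) (x : Euc m) (w : Fin m → ℝ) :
    w ⬝ᵥ (hessMatrix f x).mulVec w =
      fderiv ℝ (fderiv ℝ f) x (WithLp.toLp 2 w) (WithLp.toLp 2 w) := by
  have e : (WithLp.toLp 2 w : Euc m) = ∑ i, w i • EuclideanSpace.single i (1:ℝ) := by
    ext j
    simp [Finset.sum_apply, Pi.single_apply]
  conv_rhs => rw [e]
  simp only [map_sum, map_smul, sum_apply, smul_apply,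
    dotProduct, Matrix.mulVec, hessMatrix_apply, smul_eq_mul, Finset.mul_sum]
  rw [Finset.sum_comm]
  refine Finset.sum_congr rfl fun i _ => Finset.sum_congr rfl fun j _ => ?_
  ring

lemma hess_herm {m : ℕ} (f : Euc m → ℝ) (x : Euc m) (hf : ContDiffAt ℝ 2 f x) :
    (hessMatrix f x).IsHermitian := by
  ext i j
  simp only [Matrix.conjTranspose_apply, star_trivial, hessMatrix_apply]
  exact (hf.isSymmSndFDerivAt (by simp)) _ _

lemma hess_posSemidef {m : ℕ} (f : Euc m → ℝ) (x : Euc m) (hf : ContDiffAt ℝ 2 f x)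
    (h : ∀ v, 0 ≤ fderiv ℝ (fderiv ℝ f) x v v) : (hessMatrix f x).PosSemidef := by
  refine Matrix.PosSemidef.of_dotProduct_mulVec_nonneg (hess_herm f x hf) fun w => ?_
  rw [star_trivial, hess_quad]
  exact h _

lemma snd_fderiv_sub {m : ℕ} (f g : Euc m → ℝ) (x : Euc m) (hf : ContDiffAt ℝ 2 f x)
    (hg : ContDiffAt ℝ 2 g x) :
    fderiv ℝ (fderiv ℝ (fun y => f y - g y)) x
      = fderiv ℝ (fderiv ℝ f) x - fderiv ℝ (fderiv ℝ g) x := by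
  have h1 : fderiv ℝ (fun y => f y - g y) =ᶠ[nhds x] fun y => fderiv ℝ f y - fderiv ℝ g y := by
    filter_upwards [hf.eventually (by simp), hg.eventually (by simp)] with y hy hy'
    exact fderiv_fun_sub (hy.differentiableAt (by simp)) (hy'.differentiableAt (by simp))
  rw [h1.fderiv_eq]
  exact fderiv_fun_sub
    ((hf.fderiv_right (m := 1) (by norm_num)).differentiableAt (by simp))
    ((hg.fderiv_right (m := 1) (by norm_num)).differentiableAt (by simp))

lemma hess_convex {m : ℕ} (f : Euc m → ℝ) (Ω : Set (Euc m)) (hΩ : IsOpen Ω)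
    (hf : ContDiffOn ℝ 2 f Ω) (hc : ConvexOn ℝ Ω f) (x : Euc m) (hx : x ∈ Ω) :
    (hessMatrix f x).PosSemidef := by
  have hfx : ContDiffAt ℝ 2 f x := hf.contDiffAt (hΩ.mem_nhds hx)
  refine hess_posSemidef f x hfx fun v => ?_
  have hL : ContDiffAt ℝ 2 (fun y => fderiv ℝ f x y) x :=
    (fderiv ℝ f x).contDiff.contDiffAt
  have h0 : fderiv ℝ (fderiv ℝ (fun y => fderiv ℝ f x y)) x = 0 := by
    have : fderiv ℝ (fun y => fderiv ℝ f x y) = fun _ => fderiv ℝ f x := by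
      ext1 y
      exact (fderiv ℝ f x).fderiv
    rw [this]; simp
  have hs := snd_fderiv_sub f _ x hfx hL
  rw [h0, sub_zero] at hs
  rw [← hs]
  apply snd_fderiv_nonneg_of_localMin _ _ _ (hfx.sub hL)
  have hcv : ConvexOn ℝ Ω (fun y => f y - fderiv ℝ f x y) := by
    refine hc.sub ?_
    exact ((fderiv ℝ f x).toLinearMap.concaveOn hc.1)
  have hd : HasFDerivAt (fun y => f y - fderiv ℝ f x y) (0 : Euc m →L[ℝ] ℝ) x := by
    have := (hfx.differentiableAt (by simp)).hasFDerivAt.sub (fderiv ℝ f x).hasFDerivAt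
    rw [sub_self] at this
    exact this
  -- along a line
  filter_upwards [hΩ.mem_nhds hx] with y hy
  have hline : ∀ t : ℝ, HasDerivAt (fun t : ℝ => x + t • (y - x)) (y - x) t := by
    intro t
    simpa using ((hasDerivAt_id t).smul_const (y - x)).const_add x
  by_contra hlt
  push Not at hlt
  set k : Euc m → ℝ := fun y => f y - fderiv ℝ f x y with hk
  have hd' : HasDerivAt (fun t : ℝ => k (x + t • (y - x))) 0 0 := by
    have h5 : HasFDerivAt k (0 : Euc m →L[ℝ] ℝ) (x + (0:ℝ) • (y - x)) := by simpa using hd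
    have h6 := h5.comp_hasDerivAt 0 (hline 0)
    rw [zero_apply] at h6
    exact h6
  have hslope := hd'.tendsto_slope_zero_right
  have hle : ∀ᶠ t in nhdsWithin (0:ℝ) (Set.Ioi 0),
      t⁻¹ • (k (x + (0 + t) • (y - x)) - k (x + (0:ℝ) • (y - x))) ≤ k y - k x := by
    filter_upwards [Ioo_mem_nhdsGT (show (0:ℝ) < 1 by norm_num)] with t ht
    have := hcv.2 hx hy (show (0:ℝ) ≤ 1 - t by linarith [ht.2]) ht.1.le (by ring)
    have e : (1 - t) • x + t • y = x + (0 + t) • (y - x) := by module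
    rw [e] at this
    simp only [smul_eq_mul] at this
    rw [zero_smul, add_zero, smul_eq_mul, inv_mul_le_iff₀ ht.1]
    linarith
  have := le_of_tendsto hslope hle
  linarith

lemma comparison {m : ℕ} (D : Set (Euc m)) (hD : IsOpen D) (G H : Euc m → ℝ)
    (hG : ∀ x ∈ D, ContDiffAt ℝ 2 G x) (hH : ∀ x ∈ D, ContDiffAt ℝ 2 H x)
    (hpsd : ∀ x ∈ D, (hessMatrix G x).PosSemidef)
    (hdG : ∀ x ∈ D, Real.exp (2 * G x) ≤ (hessMatrix G x).det)
    (hdH : ∀ x ∈ D, (hessMatrix H x).det ≤ Real.exp (2 * H x))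
    (hK : ∀ δ : ℝ, 0 < δ → IsCompact {x | x ∈ D ∧ δ ≤ G x - H x}) :
    ∀ x ∈ D, G x ≤ H x := by
  intro x0 hx0
  by_contra hlt
  push Not at hlt
  have hcont : ContinuousOn (fun x => G x - H x) {x | x ∈ D ∧ G x0 - H x0 ≤ G x - H x} :=
    fun x hx => ((hG x hx.1).continuousAt.sub (hH x hx.1).continuousAt).continuousWithinAt
  obtain ⟨x1, hx1, hmax⟩ := (hK (G x0 - H x0) (by linarith)).exists_isMaxOn ⟨x0, hx0, le_rfl⟩ hcont
  have hmin : IsLocalMin (fun y => H y - G y) x1 := by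
    filter_upwards [hD.mem_nhds hx1.1] with y hy
    by_cases hy2 : G x0 - H x0 ≤ G y - H y
    · have := hmax ⟨hy, hy2⟩
      simp only [Set.mem_ofPred_eq] at this
      linarith
    · have := hx1.2
      linarith
  have hG1 := hG x1 hx1.1
  have hH1 := hH x1 hx1.1
  have hP : (hessMatrix H x1 - hessMatrix G x1).PosSemidef := by
    have e : hessMatrix H x1 - hessMatrix G x1 = hessMatrix (fun y => H y - G y) x1 := by
      ext i j
      rw [Matrix.sub_apply, hessMatrix_apply, hessMatrix_apply, hessMatrix_apply,
        snd_fderiv_sub H G x1 hH1 hG1]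
      rfl
    rw [e]
    exact hess_posSemidef _ _ (hH1.sub hG1)
      (fun v => snd_fderiv_nonneg_of_localMin _ _ _ (hH1.sub hG1) hmin)
  have h1 := (hdG x1 hx1.1).trans ((det_mono _ _ (hpsd x1 hx1.1) hP).trans (hdH x1 hx1.1))
  have h2 := Real.exp_le_exp.1 h1
  have := hx1.2
  linarith

/-- one-variable barrier, first derivative -/
lemma barrier_d1 (r t : ℝ) (h : 0 < r ^ 2 - t ^ 2) :
    HasDerivAt (fun t : ℝ => -Real.log (r ^ 2 - t ^ 2)) (2 * t / (r ^ 2 - t ^ 2)) t := by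
  have h1 : HasDerivAt (fun t : ℝ => r ^ 2 - t ^ 2) (-(2 * t)) t := by
    simpa using ((hasDerivAt_id t).pow 2).const_sub (r ^ 2)
  have h2 := (h1.log h.ne').neg
  have e : -(-(2 * t) / (r ^ 2 - t ^ 2)) = 2 * t / (r ^ 2 - t ^ 2) := by ring
  rw [e] at h2
  exact h2

lemma barrier_d2 (r t : ℝ) (h : 0 < r ^ 2 - t ^ 2) :
    HasDerivAt (fun t : ℝ => 2 * t / (r ^ 2 - t ^ 2))
      (2 * (r ^ 2 + t ^ 2) / (r ^ 2 - t ^ 2) ^ 2) t := by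
  have h1 : HasDerivAt (fun t : ℝ => r ^ 2 - t ^ 2) (-(2 * t)) t := by
    simpa using ((hasDerivAt_id t).pow 2).const_sub (r ^ 2)
  have h2 : HasDerivAt (fun t : ℝ => 2 * t) 2 t := by
    simpa using (hasDerivAt_id t).const_mul 2
  have h3 := h2.div h1 h.ne'
  have e : (2 * (r ^ 2 - t ^ 2) - 2 * t * -(2 * t)) = 2 * (r ^ 2 + t ^ 2) := by ring
  rw [e] at h3
  exact h3

def boxBarrier {m : ℕ} (a : Euc m) (r : ℝ) (z : Euc m) : ℝ :=
  (m : ℝ) * Real.log (2 * r) + ∑ i, -Real.log (r ^ 2 - (z i - a i) ^ 2)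

def openBox {m : ℕ} (a : Euc m) (r : ℝ) : Set (Euc m) :=
  {z | ∀ i, 0 < r ^ 2 - (z i - a i) ^ 2}

lemma isOpen_openBox {m : ℕ} (a : Euc m) (r : ℝ) : IsOpen (openBox a r) := by
  have : openBox a r = ⋂ i, {z : Euc m | 0 < r ^ 2 - (z i - a i) ^ 2} := by
    ext z; simp [openBox]
  rw [this]
  refine isOpen_iInter_of_finite fun i => isOpen_lt continuous_const (by fun_prop)

lemma hasFDerivAt_coord {m : ℕ} (a : Euc m) (i : Fin m) (z : Euc m) :
    HasFDerivAt (fun z : Euc m => z i - a i) (EuclideanSpace.proj (𝕜 := ℝ) i : Euc m →L[ℝ] ℝ) z := by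
  have h := (EuclideanSpace.proj (𝕜 := ℝ) i : Euc m →L[ℝ] ℝ).hasFDerivAt (x := z)
  exact h.sub_const (a i)

lemma boxBarrier_contDiffAt {m : ℕ} (a : Euc m) (r : ℝ) (z : Euc m) (hz : z ∈ openBox a r) :
    ContDiffAt ℝ 2 (boxBarrier a r) z := by
  unfold boxBarrier
  refine contDiffAt_const.add (ContDiffAt.sum fun i _ => ?_)
  have h1 : ContDiffAt ℝ 2 (fun y : Euc m => r ^ 2 - (y i - a i) ^ 2) z := by fun_prop
  exact (h1.log (hz i).ne').neg

lemma boxBarrier_hess {m : ℕ} (a : Euc m) (r : ℝ) (z : Euc m) (hz : z ∈ openBox a r) :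
    hessMatrix (boxBarrier a r) z = Matrix.diagonal fun i =>
      2 * (r ^ 2 + (z i - a i) ^ 2) / (r ^ 2 - (z i - a i) ^ 2) ^ 2 := by
  have h1 : ∀ y ∈ openBox a r, HasFDerivAt (boxBarrier a r)
      (∑ i, (2 * (y i - a i) / (r ^ 2 - (y i - a i) ^ 2)) •
        (EuclideanSpace.proj (𝕜 := ℝ) i : Euc m →L[ℝ] ℝ)) y := by
    intro y hy
    unfold boxBarrier
    refine HasFDerivAt.const_add _ (HasFDerivAt.fun_sum fun i _ => ?_)
    have h5 := HasDerivAt.comp_hasFDerivAt (f := fun z : Euc m => z i - a i) y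
      (barrier_d1 r (y i - a i) (hy i)) (hasFDerivAt_coord a i y)
    exact h5
  have h2 : fderiv ℝ (boxBarrier a r) =ᶠ[nhds z] fun y =>
      (∑ i, (2 * (y i - a i) / (r ^ 2 - (y i - a i) ^ 2)) •
        (EuclideanSpace.proj (𝕜 := ℝ) i : Euc m →L[ℝ] ℝ)) := by
    filter_upwards [(isOpen_openBox a r).mem_nhds hz] with y hy
    exact (h1 y hy).fderiv
  have h3 : HasFDerivAt (fun y : Euc m =>
      (∑ i, (2 * (y i - a i) / (r ^ 2 - (y i - a i) ^ 2)) •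
        (EuclideanSpace.proj (𝕜 := ℝ) i : Euc m →L[ℝ] ℝ)))
      (∑ i, ((2 * (r ^ 2 + (z i - a i) ^ 2) / (r ^ 2 - (z i - a i) ^ 2) ^ 2) •
        (EuclideanSpace.proj (𝕜 := ℝ) i : Euc m →L[ℝ] ℝ)).smulRight
          (EuclideanSpace.proj (𝕜 := ℝ) i : Euc m →L[ℝ] ℝ)) z := by
    refine HasFDerivAt.fun_sum fun i _ => ?_
    have h4 := HasDerivAt.comp_hasFDerivAt (f := fun z : Euc m => z i - a i) z
      (barrier_d2 r (z i - a i) (hz i)) (hasFDerivAt_coord a i z)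
    exact h4.smul_const (EuclideanSpace.proj (𝕜 := ℝ) i : Euc m →L[ℝ] ℝ)
  ext i j
  rw [hessMatrix_apply, h2.fderiv_eq, h3.fderiv]
  simp only [sum_apply, ContinuousLinearMap.smulRight_apply, smul_apply,
    PiLp.proj_apply, smul_eq_mul, Matrix.diagonal_apply]
  rw [Finset.sum_eq_single i]
  · by_cases hij : i = j
    · subst hij; simp
    · simp [hij]
  · intro k _ hk
    simp [hk]
  · simp

lemma boxBarrier_det {m : ℕ} (a : Euc m) (r : ℝ) (hr : 0 < r) (z : Euc m)
    (hz : z ∈ openBox a r) :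
    (hessMatrix (boxBarrier a r) z).det ≤ Real.exp (2 * boxBarrier a r z) := by
  rw [boxBarrier_hess a r z hz, Matrix.det_diagonal]
  have e : Real.exp (2 * boxBarrier a r z) =
      ∏ i : Fin m, (4 * r ^ 2 / (r ^ 2 - (z i - a i) ^ 2) ^ 2) := by
    have : 2 * boxBarrier a r z =
        ∑ i : Fin m, (2 * Real.log (2 * r) + 2 * -Real.log (r ^ 2 - (z i - a i) ^ 2)) := by
      unfold boxBarrier
      rw [Finset.sum_add_distrib, mul_add, Finset.mul_sum]
      congr 1
      simp
      ring
    rw [this, Real.exp_sum]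
    refine Finset.prod_congr rfl fun i _ => ?_
    have h1 : 2 * Real.log (2 * r) + 2 * -Real.log (r ^ 2 - (z i - a i) ^ 2)
      = Real.log (4 * r ^ 2 / (r ^ 2 - (z i - a i) ^ 2) ^ 2) := by
      rw [Real.log_div (by positivity) (pow_ne_zero _ (hz i).ne'), Real.log_pow,
        show (4 * r ^ 2) = (2 * r) ^ 2 by ring, Real.log_pow]
      push_cast; ring
    rw [h1, Real.exp_log]
    have := hz i
    positivity
  rw [e]
  refine Finset.prod_le_prod (fun i _ => ?_) fun i _ => ?_
  · positivity
  · have := hz i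
    refine div_le_div_of_nonneg_right ?_ (by positivity)
    linarith

lemma box_bound {m : ℕ} (Ω : Set (Euc m)) (hΩ : IsOpen Ω) (G : Euc m → ℝ)
    (hG₁ : ContDiffOn ℝ 2 G Ω) (hG₂ : ConvexOn ℝ Ω G)
    (hG₃ : ∀ x ∈ Ω, Real.exp (2 * G x) ≤ (hessMatrix G x).det)
    (a : Euc m) (r : ℝ) (hr : 0 < r) (hbox : ∀ z : Euc m, (∀ i, |z i - a i| ≤ r) → z ∈ Ω) :
    G a ≤ (m : ℝ) * Real.log (2 * r) - m * Real.log (r ^ 2) := by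
  have hsub : openBox a r ⊆ Ω := fun z hz => hbox z fun i =>
    abs_le_of_sq_le_sq (by linarith [hz i]) hr.le
  have key := comparison (openBox a r) (isOpen_openBox a r) G (boxBarrier a r)
    (fun x hx => hG₁.contDiffAt (hΩ.mem_nhds (hsub hx)))
    (fun x hx => boxBarrier_contDiffAt a r x hx)
    (fun x hx => hess_convex G Ω hΩ hG₁ hG₂ x (hsub hx))
    (fun x hx => hG₃ x (hsub hx))
    (fun x hx => boxBarrier_det a r hr x hx) ?_ a (by intro i; simpa using pow_pos hr 2)
  · refine key.trans (le_of_eq ?_)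
    simp [boxBarrier]
    ring
  intro δ hδ
  set B : Set (Euc m) := {z | ∀ i, |z i - a i| ≤ r} with hB
  have hBc : IsCompact B := by
    refine Metric.isCompact_of_isClosed_isBounded ?_ ?_
    · have : B = ⋂ i, {z : Euc m | |z i - a i| ≤ r} := by ext z; simp [hB]
      rw [this]
      exact isClosed_iInter fun i => isClosed_le (by fun_prop) continuous_const
    · refine (Metric.isBounded_iff_subset_closedBall a).2 ⟨Real.sqrt (∑ _i : Fin m, r ^ 2), fun z hz => ?_⟩
      rw [Metric.mem_closedBall, EuclideanSpace.dist_eq]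
      refine Real.sqrt_le_sqrt (Finset.sum_le_sum fun i _ => ?_)
      rw [Real.dist_eq]
      have := hz i
      gcongr
  have hcont : ContinuousOn (fun z : Euc m => (∏ i, (r ^ 2 - (z i - a i) ^ 2)) *
      Real.exp (G z - m * Real.log (2 * r) - δ)) B := by
    have hGc : ContinuousOn G B := hG₁.continuousOn.mono fun z hz => hbox z hz
    refine ContinuousOn.mul (Continuous.continuousOn (by fun_prop)) ?_
    exact Real.continuous_exp.comp_continuousOn ((hGc.sub continuousOn_const).sub continuousOn_const)
  have hcl := hcont.preimage_isClosed_of_isClosed hBc.isClosed (isClosed_Ici (a := (1:ℝ)))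
  have hcp := hBc.of_isClosed_subset hcl Set.inter_subset_left
  convert hcp using 1
  have haux : ∀ z ∈ openBox a r, (δ ≤ G z - boxBarrier a r z ↔
      1 ≤ (∏ i, (r ^ 2 - (z i - a i) ^ 2)) * Real.exp (G z - m * Real.log (2 * r) - δ)) := by
    intro z hz
    have h1 : (∏ i, (r ^ 2 - (z i - a i) ^ 2)) = Real.exp (∑ i, Real.log (r ^ 2 - (z i - a i) ^ 2)) := by
      rw [Real.exp_sum]
      exact Finset.prod_congr rfl fun i _ => (Real.exp_log (hz i)).symm
    rw [h1, ← Real.exp_add, Real.one_le_exp_iff]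
    simp only [boxBarrier, Finset.sum_neg_distrib]
    constructor <;> intro h <;> linarith
  ext z
  constructor
  · rintro ⟨hz, hz2⟩
    exact ⟨fun i => abs_le_of_sq_le_sq (by linarith [hz i]) hr.le, (haux z hz).1 hz2⟩
  · rintro ⟨hz, hz2⟩
    have hz2' : 1 ≤ (∏ i, (r ^ 2 - (z i - a i) ^ 2)) * Real.exp (G z - m * Real.log (2 * r) - δ) := hz2
    have hzo : z ∈ openBox a r := by
      intro i
      have h1 : 0 ≤ r ^ 2 - (z i - a i) ^ 2 := by
        have := sq_le_sq' (abs_le.1 (hz i)).1 (abs_le.1 (hz i)).2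
        linarith
      rcases h1.eq_or_lt with h | h
      · rw [Finset.prod_eq_zero (Finset.mem_univ i) h.symm] at hz2'
        norm_num at hz2'
      · exact h
    exact ⟨hzo, (haux z hzo).2 hz2'⟩

lemma cone_smul {m : ℕ} {Ω : Set (Euc m)} (hΩ : IsOpenProperConvexCone Ω) {x : Euc m}
    (hx : x ∈ Ω) {t : ℝ} (ht : 0 < t) : t • x ∈ Ω := by
  have := hΩ.2.2.2.1 x hx (Real.log t)
  rwa [Real.exp_log ht] at this

lemma cone_add {m : ℕ} {Ω : Set (Euc m)} (hΩ : IsOpenProperConvexCone Ω) {x y : Euc m}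
    (hx : x ∈ Ω) (hy : y ∈ Ω) : x + y ∈ Ω := by
  have h := hΩ.2.2.1 hx hy (show (0:ℝ) ≤ 1 / 2 by norm_num) (show (0:ℝ) ≤ 1 / 2 by norm_num)
    (by norm_num)
  have h2 := cone_smul hΩ h (show (0:ℝ) < 2 by norm_num)
  have e : (2:ℝ) • ((1 / 2 : ℝ) • x + (1 / 2 : ℝ) • y) = x + y := by module
  rwa [e] at h2

lemma closure_smul_mem {m : ℕ} {Ω : Set (Euc m)} (hΩ : IsOpenProperConvexCone Ω) {x : Euc m}
    (hx : x ∈ closure Ω) {t : ℝ} (ht : 0 < t) : t • x ∈ closure Ω :=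
  map_mem_closure (f := fun y : Euc m => t • y) (continuous_const_smul t) hx
    (fun _ hy => cone_smul hΩ hy ht)

lemma zero_mem_closure {m : ℕ} {Ω : Set (Euc m)} (hΩ : IsOpenProperConvexCone Ω) :
    (0 : Euc m) ∈ closure Ω := by
  obtain ⟨p, hp⟩ := hΩ.1
  have h : Filter.Tendsto (fun t : ℝ => t • p) (nhdsWithin 0 (Set.Ioi 0)) (nhds ((0:ℝ) • p)) :=
    (Continuous.tendsto (by fun_prop) 0).mono_left nhdsWithin_le_nhds
  rw [zero_smul] at h
  refine mem_closure_of_tendsto h ?_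
  filter_upwards [self_mem_nhdsWithin] with t ht
  exact cone_smul hΩ hp ht

lemma exists_functional {m : ℕ} {Ω : Set (Euc m)} (hΩ : IsOpenProperConvexCone Ω) :
    ∃ (l : Euc m →L[ℝ] ℝ) (c : ℝ), 0 < c ∧ ∀ x ∈ Ω, c * ‖x‖ ≤ l x := by
  have hloc : ∀ x ∈ closure Ω, x ≠ 0 → ∃ f : Euc m →L[ℝ] ℝ, (∀ y ∈ closure Ω, 0 ≤ f y) ∧ 0 < f x := by
    intro x hx hx0
    have hneg : -x ∉ closure Ω := by
      intro hnx
      refine hΩ.2.2.2.2 ⟨0, x, hx0, fun t => ?_⟩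
      rw [zero_add]
      rcases lt_trichotomy t 0 with h | h | h
      · have := closure_smul_mem hΩ hnx (neg_pos.2 h)
        simpa using this
      · rw [h, zero_smul]; exact zero_mem_closure hΩ
      · exact closure_smul_mem hΩ hx h
    obtain ⟨f, u, hf1, hf2⟩ := geometric_hahn_banach_point_closed hΩ.2.2.1.closure isClosed_closure hneg
    have hu : u < 0 := by simpa using hf2 0 (zero_mem_closure hΩ)
    refine ⟨f, fun y hy => ?_, ?_⟩
    · by_contra hlt
      push Not at hlt
      have h1 := hf2 _ (closure_smul_mem hΩ hy (div_pos_of_neg_of_neg hu hlt))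
      rw [map_smul, smul_eq_mul, div_mul_cancel₀ _ hlt.ne] at h1
      exact lt_irrefl _ h1
    · rw [map_neg] at hf1
      linarith
  set K : Set (Euc m) := closure Ω ∩ Metric.sphere 0 1 with hKdef
  have hK : IsCompact K := (isCompact_sphere 0 1).inter_left isClosed_closure
  have hP : ∃ f : Euc m →L[ℝ] ℝ, (∀ y ∈ closure Ω, 0 ≤ f y) ∧ ∀ x ∈ K, 0 < f x := by
    refine hK.induction_on (p := fun s => ∃ f : Euc m →L[ℝ] ℝ, (∀ y ∈ closure Ω, 0 ≤ f y) ∧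
      ∀ x ∈ s ∩ closure Ω, 0 < f x) ⟨0, by simp, by simp⟩ ?_ ?_ ?_ |> fun ⟨f, h1, h2⟩ => ⟨f, h1, fun x hx => h2 x ⟨hx, hx.1⟩⟩
    · rintro s t hst ⟨f, h1, h2⟩
      exact ⟨f, h1, fun x hx => h2 x ⟨hst hx.1, hx.2⟩⟩
    · rintro s t ⟨f, h1, h2⟩ ⟨g, h3, h4⟩
      refine ⟨f + g, fun y hy => add_nonneg (h1 y hy) (h3 y hy), ?_⟩
      rintro x ⟨hx | hx, hxc⟩
      · exact add_pos_of_pos_of_nonneg (h2 x ⟨hx, hxc⟩) (h3 x hxc)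
      · exact add_pos_of_nonneg_of_pos (h1 x hxc) (h4 x ⟨hx, hxc⟩)
    · intro x hx
      obtain ⟨f, h1, h2⟩ := hloc x hx.1 (by
        rintro rfl
        have := hx.2
        simp at this)
      refine ⟨{y | 0 < f y}, mem_nhdsWithin_of_mem_nhds
        ((isOpen_lt continuous_const f.continuous).mem_nhds h2), f, h1, fun y hy => hy.1⟩
  obtain ⟨f, h1, h2⟩ := hP
  obtain ⟨c, hc, hcK⟩ := hK.exists_forall_le' f.continuous.continuousOn h2
  refine ⟨f, c, hc, fun x hx => ?_⟩
  rcases eq_or_ne x 0 with rfl | hx0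
  · simp
  have hn : 0 < ‖x‖ := norm_pos_iff.2 hx0
  have h3 := hcK (‖x‖⁻¹ • x) ⟨subset_closure (cone_smul hΩ hx (inv_pos.2 hn)), by
    simp [norm_smul, hn.ne']⟩
  rw [map_smul, smul_eq_mul, inv_mul_eq_div, le_div_iff₀ hn] at h3
  exact h3

lemma potential_lower (n : ℕ) (Ω : Set (Euc (n + 1))) (hΩ : IsOpenProperConvexCone Ω)
    (F : Euc (n + 1) → ℝ) (hF : IsCanonicalPotential n Ω F) :
    ∃ C : ℝ, ∀ y ∈ Ω, 0 < ‖y‖ ∧ -C - (n + 1) * Real.log ‖y‖ ≤ F y := by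
  have h0 : (0 : Euc (n + 1)) ∉ Ω := by
    intro h
    have := hF.2.2.2.1 0 h 1
    rw [smul_zero] at this
    have h2 : (0:ℝ) ≤ n := Nat.cast_nonneg n
    linarith
  obtain ⟨C, hC⟩ : ∃ C : ℝ, ∀ u ∈ Ω, ‖u‖ = 1 → -C ≤ F u := by
    by_contra hcon
    push Not at hcon
    choose u hu hu1 hFu using fun k : ℕ => hcon k
    have hcs : ∀ k, u k ∈ Metric.sphere (0 : Euc (n + 1)) 1 := fun k => by simp [hu1 k]
    obtain ⟨z, -, φ, hφ, hz⟩ := (isCompact_sphere (0 : Euc (n + 1)) 1).tendsto_subseq hcs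
    have hlim : Filter.Tendsto (fun k => F (u (φ k))) Filter.atTop Filter.atBot := by
      refine Filter.tendsto_atBot_mono (fun k => (hFu (φ k)).le) ?_
      exact Filter.tendsto_neg_atTop_atBot.comp
        (tendsto_natCast_atTop_atTop.comp hφ.tendsto_atTop)
    have hzc : z ∈ closure Ω := mem_closure_of_tendsto hz (Filter.Eventually.of_forall fun k => hu _)
    by_cases hzΩ : z ∈ Ω
    · have hc : ContinuousAt F z := (hF.1.continuousOn).continuousAt (hΩ.2.1.mem_nhds hzΩ)
      exact not_tendsto_nhds_of_tendsto_atBot hlim (F z) (hc.tendsto.comp hz)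
    · have hfr : z ∈ frontier Ω := by
        rw [hΩ.2.1.frontier_eq]; exact ⟨hzc, hzΩ⟩
      have := hF.2.2.2.2 z hfr (fun k => u (φ k)) (fun k => hu _) hz
      exact this.not_tendsto Filter.disjoint_atTop_atBot hlim
  refine ⟨C, fun y hy => ?_⟩
  have hy0 : y ≠ 0 := fun h => h0 (h ▸ hy)
  have hn : 0 < ‖y‖ := norm_pos_iff.2 hy0
  refine ⟨hn, ?_⟩
  have hu : ‖y‖⁻¹ • y ∈ Ω := cone_smul hΩ hy (inv_pos.2 hn)
  have h1 := hF.2.2.2.1 _ hu (Real.log ‖y‖)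
  rw [Real.exp_log hn, smul_smul, mul_inv_cancel₀ hn.ne', one_smul] at h1
  have h2 := hC _ hu (by simp [norm_smul, hn.ne'])
  linarith

lemma shifted_hess {m : ℕ} (F : Euc m → ℝ) (l : Euc m →L[ℝ] ℝ) (q x : Euc m)
    (hF : ContDiffAt ℝ 2 F (x - q)) :
    ContDiffAt ℝ 2 (fun y => F (y - q) + l y) x ∧
    hessMatrix (fun y => F (y - q) + l y) x = hessMatrix F (x - q) := by
  have hs : ContDiffAt ℝ 2 (fun y : Euc m => y - q) x := by fun_prop
  have hcomp : ContDiffAt ℝ 2 (fun y => F (y - q)) x := ContDiffAt.comp x hF hs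
  refine ⟨hcomp.add l.contDiff.contDiffAt, ?_⟩
  have h1 : fderiv ℝ (fun y => F (y - q) + l y) =ᶠ[nhds x] fun y => fderiv ℝ F (y - q) + l := by
    filter_upwards [hcomp.eventually (by simp)] with y hy
    rw [fderiv_fun_add (hy.differentiableAt (by simp)) l.differentiableAt, l.fderiv,
      fderiv_comp_sub]
  ext i j
  rw [hessMatrix_apply, hessMatrix_apply, h1.fderiv_eq, fderiv_add_const, fderiv_comp_sub]

lemma shifted_comparison
    (n : ℕ) (Ω : Set (Euc (n + 1))) (hΩ : IsOpenProperConvexCone Ω)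
    (F : Euc (n + 1) → ℝ) (hF : IsCanonicalPotential n Ω F)
    (G : Euc (n + 1) → ℝ) (hG₁ : ContDiffOn ℝ 2 G Ω) (hG₂ : ConvexOn ℝ Ω G)
    (hG₃ : ∀ x ∈ Ω, Real.exp (2 * G x) ≤ (hessMatrix G x).det)
    (l : Euc (n + 1) →L[ℝ] ℝ) (c : ℝ) (hc : 0 < c) (hl : ∀ x ∈ Ω, c * ‖x‖ ≤ l x)
    (q : Euc (n + 1)) (hq : q ∈ Ω) (x : Euc (n + 1)) (hx : x - q ∈ Ω) :
    G x ≤ F (x - q) + l x := by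
  set D : Set (Euc (n + 1)) := {x | x - q ∈ Ω} with hDdef
  have hDo : IsOpen D := hΩ.2.1.preimage (by fun_prop : Continuous fun x : Euc (n + 1) => x - q)
  have hDΩ : ∀ y ∈ D, y ∈ Ω := fun y hy => by simpa using cone_add hΩ hy hq
  have hl0 : ∀ y ∈ Ω, 0 ≤ l y := fun y hy => (by positivity : 0 ≤ c * ‖y‖).trans (hl y hy)
  -- `G` is bounded above on `D`
  obtain ⟨C, hC⟩ : ∃ C : ℝ, ∀ y ∈ D, G y ≤ C := by
    obtain ⟨δ, hδ, hball⟩ := Metric.isOpen_iff.1 hΩ.2.1 q hq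
    refine ⟨_, fun y hy => box_bound Ω hΩ.2.1 G hG₁ hG₂ hG₃ y (δ / (n + 2)) (by positivity) ?_⟩
    intro z hz
    have hn : ‖z - y‖ < δ := by
      have h1 : ‖z - y‖ ≤ (n + 1) * (δ / (n + 2)) := by
        rw [EuclideanSpace.norm_eq]
        refine Real.sqrt_le_iff.2 ⟨by positivity, ?_⟩
        calc ∑ i, ‖(z - y) i‖ ^ 2 ≤ ∑ _i : Fin (n + 1), (δ / (n + 2)) ^ 2 := by
              refine Finset.sum_le_sum fun i _ => ?_
              have := hz i
              rw [Real.norm_eq_abs]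
              exact pow_le_pow_left₀ (abs_nonneg _) this 2
          _ = (n + 1) * (δ / (n + 2)) ^ 2 := by simp
          _ ≤ ((n + 1) * (δ / (n + 2))) ^ 2 := by
              have h2 : (0:ℝ) ≤ n := Nat.cast_nonneg n
              have h3 : (0:ℝ) ≤ (δ / (n + 2)) ^ 2 := by positivity
              rw [mul_pow]
              refine mul_le_mul_of_nonneg_right ?_ h3
              nlinarith
      have h4 : (n + 1) * (δ / (n + 2)) < δ := by
        have h2 : (0:ℝ) ≤ n := Nat.cast_nonneg n
        rw [← mul_div_assoc, div_lt_iff₀ (by positivity)]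
        nlinarith
      exact h1.trans_lt h4
    have h5 : q + (z - y) ∈ Ω := hball (by simpa [dist_eq_norm] using hn)
    have h6 := cone_add hΩ hy h5
    have e : y - q + (q + (z - y)) = z := by abel
    rwa [e] at h6
  obtain ⟨C2, hC2⟩ := potential_lower n Ω hΩ F hF
  have hF2 : ∀ y ∈ Ω, ContDiffAt ℝ 2 F y := fun y hy =>
    (hF.1.contDiffAt (hΩ.2.1.mem_nhds hy)).of_le (WithTop.coe_le_coe.2 (le_top : (2 : ℕ∞) ≤ ⊤))
  refine comparison D hDo G (fun y => F (y - q) + l y)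
    (fun y hy => hG₁.contDiffAt (hΩ.2.1.mem_nhds (hDΩ y hy)))
    (fun y hy => (shifted_hess F l q y (hF2 _ hy)).1)
    (fun y hy => hess_convex G Ω hΩ.2.1 hG₁ hG₂ y (hDΩ y hy))
    (fun y hy => hG₃ y (hDΩ y hy)) ?_ ?_ x hx
  · intro y hy
    rw [(shifted_hess F l q y (hF2 _ hy)).2, hF.2.2.1 _ hy]
    have := hl0 y (hDΩ y hy)
    exact Real.exp_le_exp.2 (by linarith)
  intro δ hδ
  refine Metric.isCompact_of_isClosed_isBounded ?_ ?_
  · refine IsSeqClosed.isClosed fun u z hu hz => ?_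
    have hsh : Filter.Tendsto (fun k => u k - q) Filter.atTop (nhds (z - q)) := hz.sub_const q
    have hzc : z - q ∈ closure Ω :=
      mem_closure_of_tendsto hsh (Filter.Eventually.of_forall fun k => (hu k).1)
    by_cases hzΩ : z - q ∈ Ω
    · refine ⟨hzΩ, ?_⟩
      have hGc : ContinuousAt G z :=
        (hG₁.contDiffAt (hΩ.2.1.mem_nhds (hDΩ z hzΩ))).continuousAt
      have hHc := (shifted_hess F l q z (hF2 _ hzΩ)).1.continuousAt
      exact ge_of_tendsto ((hGc.sub hHc).tendsto.comp hz)
        (Filter.Eventually.of_forall fun k => (hu k).2)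
    · exfalso
      have hfr : z - q ∈ frontier Ω := by
        rw [hΩ.2.1.frontier_eq]; exact ⟨hzc, hzΩ⟩
      have h1 := hF.2.2.2.2 _ hfr (fun k => u k - q) (fun k => (hu k).1) hsh
      obtain ⟨k, hk⟩ := (h1.eventually (Filter.eventually_gt_atTop C)).exists
      have h2 := (hu k).2
      have h3 := hC _ (hu k).1
      have h4 := hl0 _ (hDΩ _ (hu k).1)
      linarith
  · set κ : ℝ := c / (2 * (n + 1)) with hκ
    have hκ0 : 0 < κ := by positivity
    refine (Metric.isBounded_iff_subset_closedBall q).2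
      ⟨(2 / c) * (C + C2 + (n + 1) * (-1 - Real.log κ)), fun y hy => ?_⟩
    rw [Metric.mem_closedBall, dist_eq_norm]
    obtain ⟨hs, h1⟩ := hC2 _ hy.1
    have h2 := hC _ hy.1
    have h3 := hl _ hy.1
    have h4 := hl0 q hq
    have h5 : l (y - q) = l y - l q := map_sub _ _ _
    have h6 := hy.2
    have h7 := Real.log_le_sub_one_of_pos (mul_pos hκ0 hs)
    rw [Real.log_mul hκ0.ne' hs.ne'] at h7
    have hn1 : (0:ℝ) < n + 1 := by positivity
    have h8 : (n + 1) * Real.log ‖y - q‖ ≤ (n + 1) * (κ * ‖y - q‖ - 1 - Real.log κ) :=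
      mul_le_mul_of_nonneg_left (by linarith) hn1.le
    have h9 : (n + 1) * (κ * ‖y - q‖) = c / 2 * ‖y - q‖ := by
      rw [hκ]; field_simp
    have h10 : c / 2 * ‖y - q‖ ≤ C + C2 + (n + 1) * (-1 - Real.log κ) := by
      linarith
    calc ‖y - q‖ = (2 / c) * (c / 2 * ‖y - q‖) := by field_simp
      _ ≤ _ := mul_le_mul_of_nonneg_left h10 (by positivity)

/-- Schwarz-lemma comparison: any `C²` convex `G` on `Ω` with `det D²G ≥ e^{2G}` is
dominated by the canonical potential `F` of `Ω`. -/
theorem le_canonical_potential_of_subsolution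
    (n : ℕ) (Ω : Set (Euc (n + 1))) (hΩ : IsOpenProperConvexCone Ω)
    (F : Euc (n + 1) → ℝ) (hF : IsCanonicalPotential n Ω F)
    (G : Euc (n + 1) → ℝ) (hG₁ : ContDiffOn ℝ 2 G Ω) (hG₂ : ConvexOn ℝ Ω G)
    (hG₃ : ∀ x ∈ Ω, Real.exp (2 * G x) ≤ (hessMatrix G x).det) :
    ∀ x ∈ Ω, G x ≤ F x := by

  intro x hx
  obtain ⟨l, c, hc, hl⟩ := exists_functional hΩ
  have key : ∀ ε : ℝ, 0 < ε → x - ε • x ∈ Ω → G x ≤ F (x - ε • x) + ε * l x := by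
    intro ε hε hxε
    have := shifted_comparison n Ω hΩ F hF G hG₁ hG₂ hG₃ (ε • l) (ε * c) (by positivity)
      (fun y hy => by
        have := mul_le_mul_of_nonneg_left (hl y hy) hε.le
        rw [smul_apply, smul_eq_mul, mul_assoc]
        exact this) (ε • x) (cone_smul hΩ hx hε) x hxε
    simpa using this
  have hcF : ContinuousAt F (x - (0:ℝ) • x) := by
    rw [zero_smul, sub_zero]
    exact (hF.1.continuousOn).continuousAt (hΩ.2.1.mem_nhds hx)
  have hc1 : ContinuousAt (fun ε : ℝ => x - ε • x) 0 := by fun_prop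
  have hc2 : ContinuousAt (fun ε : ℝ => F (x - ε • x) + ε * l x) 0 :=
    (ContinuousAt.comp (f := fun ε : ℝ => x - ε • x) hcF hc1).add (by fun_prop)
  have hlim := hc2.tendsto.mono_left (nhdsWithin_le_nhds (s := Set.Ioi (0:ℝ)))
  simp only [zero_smul, sub_zero, zero_mul, add_zero] at hlim
  refine ge_of_tendsto hlim ?_
  have hev : ∀ᶠ ε in nhds (0:ℝ), x - ε • x ∈ Ω :=
    hc1.eventually (by simpa using hΩ.2.1.mem_nhds hx)
  filter_upwards [self_mem_nhdsWithin, nhdsWithin_le_nhds hev] with ε h1 h2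
  exact key ε h1 h2
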